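/- arXiv:math/0406542 — 8 statements merged into one kernel-verified Lean document; each statement's English description precedes it below -/
import Mathlib

section
/- Let Γ be a finite group acting on a finite set X, and let O₁ and O₂ be two orbits of this action such that |Γ|/|O₁| and |Γ|/|O₂| are relatively prime. Then D_Γ(X) ≤ 2; moreover, if some element of Γ acts nontrivially on X, then D_Γ(X) = 2. -/
/-- A labelling `φ : X → Fin k` is distinguishing for the action of `Γ` on `X`
if every group element preserving the labelling fixes every element of `X`. -/
def IsDistinguishing (Γ : Type*) {X : Type*} [Group Γ] [MulAction Γ X] {k : ℕ}
    (φ : X → Fin k) : Prop :=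
  ∀ g : Γ, (∀ x : X, φ (g • x) = φ x) → ∀ x : X, g • x = x

/-- The distinguishing number of the action of `Γ` on `X`: the least `k`
admitting a distinguishing labelling with `k` labels. -/
noncomputable def distinguishingNumber (Γ X : Type*) [Group Γ] [MulAction Γ X] : ℕ :=
  sInf {k : ℕ | ∃ φ : X → Fin k, IsDistinguishing Γ φ}

/-- An element fixing a point has order dividing the quotient of the order of the group by the
length of the orbit. -/
theorem orderOf_dvd_card_div_ncard_orbit {Γ X : Type*} [Group Γ] [Fintype Γ] [MulAction Γ X]
    {g : Γ} {x : X} (hg : g • x = x) :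
    orderOf g ∣ Fintype.card Γ / (MulAction.orbit Γ x).ncard := by
  have hpos : 0 < (MulAction.stabilizer Γ x).index :=
    Nat.pos_of_ne_zero Subgroup.index_ne_zero_of_finite
  rw [← MulAction.index_stabilizer, ← Nat.card_eq_fintype_card,
    ← (MulAction.stabilizer Γ x).card_mul_index, Nat.mul_div_cancel _ hpos]
  exact Subgroup.orderOf_dvd_natCard _ (MulAction.mem_stabilizer_iff.2 hg)

/-- Marking one point from each of two orbits whose stabilizers have coprime orders gives a
distinguishing labelling. -/
theorem exists_isDistinguishing_of_coprime_orbits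
    {Γ X : Type*} [Group Γ] [Fintype Γ] [MulAction Γ X] (x₁ x₂ : X)
    (h : Nat.Coprime (Fintype.card Γ / (MulAction.orbit Γ x₁).ncard)
      (Fintype.card Γ / (MulAction.orbit Γ x₂).ncard)) :
    ∃ φ : X → Fin 2, IsDistinguishing Γ φ := by
  classical
  have fixes : ∀ g : Γ, g • x₁ = x₁ → g • x₂ = x₂ → g = 1 := fun g h₁ h₂ ↦
    orderOf_eq_one_iff.1 <| Nat.eq_one_of_dvd_coprimes h
      (orderOf_dvd_card_div_ncard_orbit h₁) (orderOf_dvd_card_div_ncard_orbit h₂)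
  by_cases hO : x₂ ∈ MulAction.orbit Γ x₁
  · rw [MulAction.orbit_eq_iff.2 hO] at h
    refine ⟨fun x ↦ if x = x₁ then 1 else 0, fun g hg x ↦ ?_⟩
    have h₁ : g • x₁ = x₁ := by simpa using hg x₁
    have hd := orderOf_dvd_card_div_ncard_orbit h₁
    have : g = 1 := orderOf_eq_one_iff.1 (Nat.eq_one_of_dvd_coprimes h hd hd)
    rw [this, one_smul]
  · refine ⟨fun x ↦ if x = x₁ ∨ x = x₂ then 1 else 0, fun g hg x ↦ ?_⟩
    have h₁ : g • x₁ = x₁ := by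
      have : g • x₁ = x₁ ∨ g • x₁ = x₂ := by simpa [or_iff_not_imp_left] using hg x₁
      exact this.resolve_right fun e ↦ hO ⟨g, e⟩
    have h₂ : g • x₂ = x₂ := by
      have : g • x₂ = x₁ ∨ g • x₂ = x₂ := by simpa [or_iff_not_imp_left] using hg x₂
      exact this.resolve_left fun e ↦ hO (MulAction.mem_orbit_symm.1 ⟨g, e⟩)
    rw [fixes g h₁ h₂, one_smul]

/-- A nontrivial action has no distinguishing labelling with fewer than two labels. -/
theorem IsDistinguishing.two_le {Γ X : Type*} [Group Γ] [MulAction Γ X] {k : ℕ} {φ : X → Fin k}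
    (hφ : IsDistinguishing Γ φ) {g : Γ} {x : X} (hgx : g • x ≠ x) : 2 ≤ k := by
  by_contra! hk
  have : Subsingleton (Fin k) := Fin.subsingleton_iff_le_one.2 (Nat.le_of_lt_succ hk)
  exact hgx (hφ g (fun _ ↦ Subsingleton.elim _ _) x)

/-- If two orbits `O₁ = Γ·x₁` and `O₂ = Γ·x₂` of the action of `Γ` on `X` have
`|Γ|/|O₁|` relatively prime to `|Γ|/|O₂|`, then `D_Γ(X) ≤ 2`; moreover if some
group element acts nontrivially then `D_Γ(X) = 2`. -/
theorem distinguishingNumber_eq_two_of_coprime_orbits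
    (Γ X : Type*) [Group Γ] [Fintype Γ] [MulAction Γ X] [Fintype X]
    (x₁ x₂ : X)
    (h : Nat.Coprime (Fintype.card Γ / (MulAction.orbit Γ x₁).ncard)
      (Fintype.card Γ / (MulAction.orbit Γ x₂).ncard)) :
    distinguishingNumber Γ X ≤ 2 ∧
      ((∃ (g : Γ) (x : X), g • x ≠ x) → distinguishingNumber Γ X = 2) := by
  have hmem := exists_isDistinguishing_of_coprime_orbits x₁ x₂ h
  have hle : distinguishingNumber Γ X ≤ 2 := Nat.sInf_le hmem
  refine ⟨hle, fun ⟨g, x, hgx⟩ ↦ hle.antisymm ?_⟩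
  obtain ⟨φ, hφ⟩ := Nat.sInf_mem (s := {k : ℕ | ∃ φ : X → Fin k, IsDistinguishing Γ φ}) ⟨2, hmem⟩
  exact hφ.two_le hgx
end

section
/- Let n ≥ 3 and let the symmetric group S_n act on the set S_n by conjugation (g·x = g x g⁻¹). Then D_{S_n}(S_n) = 2. -/
/-- If two non-conjugate elements generate `G`, then labelling them differently from all the other
elements is distinguishing for the conjugation action. -/
theorem exists_isDistinguishing_two_of_closure_pair {G : Type*} [Group G] {a b : G}
    (hab : ¬ IsConj a b) (hgen : Subgroup.closure {a, b} = ⊤) :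
    ∃ φ : G → Fin 2, IsDistinguishing (ConjAct G) φ := by
  classical
  refine ⟨fun x => if x = a ∨ x = b then 1 else 0, fun g hg => ?_⟩
  have hmem (x : G) (hx : x = a ∨ x = b) : g • x = a ∨ g • x = b := by
    by_contra h
    simpa [hx, h] using hg x
  have hconj (x : G) : IsConj x (g • x) :=
    isConj_iff.2 ⟨ConjAct.ofConjAct g, (ConjAct.smul_def g x).symm⟩
  have ha : g • a = a := (hmem a (.inl rfl)).resolve_right fun h => hab (h ▸ hconj a)
  have hb : g • b = b := (hmem b (.inr rfl)).resolve_left fun h => hab (h ▸ hconj b).symm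
  intro x
  have hx : x ∈ Subgroup.closure {a, b} := hgen ▸ Subgroup.mem_top x
  induction hx using Subgroup.closure_induction with
  | mem x hx => rcases hx with rfl | rfl <;> assumption
  | one => exact smul_one g
  | mul x y _ _ hx hy => rw [smul_mul', hx, hy]
  | inv x _ hx => rw [smul_inv', hx]

/-- A nontrivial action has no distinguishing labelling with fewer than two labels. -/
theorem two_le_of_isDistinguishing {Γ X : Type*} [Group Γ] [MulAction Γ X] {g : Γ} {x : X}
    (hgx : g • x ≠ x) {k : ℕ} {φ : X → Fin k} (hφ : IsDistinguishing Γ φ) : 2 ≤ k := by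
  by_contra! hk
  have : Subsingleton (Fin k) := Fin.subsingleton_iff_le_one.2 (by omega)
  exact hgx (hφ g (fun _ => Subsingleton.elim _ _) x)

/-- For `n ≥ 3`, the symmetric group `Sₙ` acting on itself by conjugation
(`g • x = g * x * g⁻¹`, encoded via `ConjAct`) has distinguishing number 2. -/
theorem distinguishingNumber_conj_symmetricGroup (n : ℕ) (hn : 3 ≤ n) :
    distinguishingNumber (ConjAct (Equiv.Perm (Fin n))) (Equiv.Perm (Fin n)) = 2 := by
  obtain ⟨m, rfl⟩ : ∃ m, n = m + 3 := ⟨n - 3, by omega⟩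
  have hsupp : (finRotate (m + 3)).support = Finset.univ := support_finRotate
  have hne : (0 : Fin (m + 3)) ≠ finRotate (m + 3) 0 :=
    (Equiv.Perm.mem_support.1 (hsupp ▸ Finset.mem_univ 0)).symm
  have hconj : ¬ IsConj (finRotate (m + 3))
      (Equiv.swap 0 (finRotate (m + 3) 0)) := by
    intro h
    have hsum := congrArg Multiset.sum (Equiv.Perm.isConj_iff_cycleType_eq.1 h)
    rw [Equiv.Perm.sum_cycleType, Equiv.Perm.sum_cycleType, hsupp,
      Equiv.Perm.card_support_swap hne, Finset.card_univ, Fintype.card_fin] at hsum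
    omega
  have hlabel := exists_isDistinguishing_two_of_closure_pair hconj
    (Equiv.Perm.closure_cycle_adjacent_swap isCycle_finRotate hsupp 0)
  refine le_antisymm (Nat.sInf_le hlabel) (le_csInf ⟨2, hlabel⟩ ?_)
  rintro k ⟨φ, hφ⟩
  let a : Fin (m + 3) := ⟨0, by omega⟩
  let b : Fin (m + 3) := ⟨1, by omega⟩
  let c : Fin (m + 3) := ⟨2, by omega⟩
  have hab : a ≠ b := by simp [a, b]
  have hac : a ≠ c := by simp [a, c]
  have hbc : b ≠ c := by simp [b, c]
  refine two_le_of_isDistinguishing (g := ConjAct.toConjAct (Equiv.swap b c))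
    (x := Equiv.swap a b) (fun h => hbc ?_) hφ
  rw [ConjAct.toConjAct_smul, ← Equiv.swap_apply_apply, Equiv.swap_apply_left,
    Equiv.swap_apply_of_ne_of_ne hab hac] at h
  simpa using (DFunLike.congr_fun h a).symm
end

section
/- Let Γ be a finite group acting on a finite set X, let Γ = Γ₁ ⊇ Γ₂ ⊇ ⋯ ⊇ Γ_j be a chain of subgroups, and let y₁, y₂, …, y_j ∈ X be such that Γ_i ⊆ Stab_{Γ_{i−1}}(y_i) for each i from 2 to j. Then |Γ| ≥ |Γ₁·y₂| · |Γ₂·y₃| ⋯ |Γ_{j−1}·y_j| · |Γ_j·y₁| · |Stab_{Γ_j}(y₁)|, where Γ_i·y denotes the orbit of y under the subgroup Γ_i. -/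
namespace MulAction

theorem natCard_orbit_mul_natCard_stabilizer (H : Type*) {X : Type*} [Group H]
    [MulAction H X] (x : X) :
    Nat.card (orbit H x) * Nat.card (stabilizer H x) = Nat.card H := by
  rw [← Nat.card_prod]
  exact Nat.card_congr (orbitProdStabilizerEquivGroup H x)

theorem natCard_orbit_mul_natCard_le_of_fixes {Γ X : Type*} [Group Γ] [Finite Γ]
    [MulAction Γ X] {H K : Subgroup Γ} (hKH : K ≤ H) {x : X} (hK : ∀ g ∈ K, g • x = x) :
    Nat.card (orbit H x) * Nat.card K ≤ Nat.card H := by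
  rw [← natCard_orbit_mul_natCard_stabilizer H x]
  refine Nat.mul_le_mul_left _ (Nat.card_le_card_of_injective
    (fun g : K => (⟨⟨g, hKH g.2⟩, hK g g.2⟩ : stabilizer H x)) fun a b hab => ?_)
  exact Subtype.ext (congrArg (fun s : stabilizer H x => (s : Γ)) hab)

theorem prod_natCard_orbit_mul_natCard_le {Γ X : Type*} [Group Γ] [Finite Γ]
    [MulAction Γ X] {j : ℕ} (hj : 1 ≤ j) (G : ℕ → Subgroup Γ) (y : ℕ → X)
    (hchain : ∀ i, 2 ≤ i → i ≤ j → G i ≤ G (i - 1) ∧ ∀ g ∈ G i, g • y i = y i) :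
    (∏ i ∈ Finset.Icc 2 j, Nat.card (orbit (G (i - 1)) (y i))) * Nat.card (G j) ≤
      Nat.card (G 1) := by
  induction j, hj using Nat.le_induction with
  | base => simp
  | succ n hn ih =>
    obtain ⟨hle, hfix⟩ := hchain (n + 1) (by omega) le_rfl
    rw [Finset.prod_Icc_succ_top (by omega), mul_assoc]
    exact (Nat.mul_le_mul_left _ (natCard_orbit_mul_natCard_le_of_fixes hle hfix)).trans
      (ih fun i hi hin => hchain i hi (by omega))

end MulAction

/-- Theorem (lower bound): if `Γ = Γ₁ ⊇ Γ₂ ⊇ ⋯ ⊇ Γⱼ` is a chain of subgroups with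
`Γᵢ ⊆ Stab_{Γ_{i-1}}(yᵢ)` for `2 ≤ i ≤ j`, then
`|Γ| ≥ |Γ₁·y₂| |Γ₂·y₃| ⋯ |Γ_{j-1}·yⱼ| |Γⱼ·y₁| |Stab_{Γⱼ}(y₁)|`.
Here the product over `i ∈ [2, j]` records the orbit `Γ_{i-1}·yᵢ`. -/
theorem card_ge_prod_orbits
    (Γ X : Type*) [Group Γ] [Fintype Γ] [MulAction Γ X] [Fintype X]
    (j : ℕ) (hj : 1 ≤ j) (G : ℕ → Subgroup Γ) (y : ℕ → X)
    (hG1 : G 1 = ⊤)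
    (hchain : ∀ i, 2 ≤ i → i ≤ j →
      G i ≤ G (i - 1) ∧ ∀ g ∈ G i, g • y i = y i) :
    (∏ i ∈ Finset.Icc 2 j, Nat.card (MulAction.orbit (↥(G (i - 1))) (y i))) *
        Nat.card (MulAction.orbit (↥(G j)) (y 1)) *
        Nat.card (MulAction.stabilizer (↥(G j)) (y 1)) ≤ Nat.card Γ := by
  rw [mul_assoc, MulAction.natCard_orbit_mul_natCard_stabilizer]
  simpa [hG1] using MulAction.prod_natCard_orbit_mul_natCard_le hj G y hchain
end

section
/- Let Γ be a finite group acting on a finite nonempty set X, and let k ≥ 1. If |Γ| ≤ k!, then D_Γ(X) ≤ k. -/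
/-- If no orbit has more than `k` points, labelling each orbit injectively is distinguishing. -/
theorem exists_isDistinguishing_of_card_orbit_le {Γ X : Type*} [Group Γ] [MulAction Γ X]
    [Finite Γ] {k : ℕ} (h : ∀ x : X, Nat.card (MulAction.orbit Γ x) ≤ k) :
    ∃ φ : X → Fin k, IsDistinguishing Γ φ := by
  have hinj (q : MulAction.orbitRel.Quotient Γ X) : ∃ f : X → Fin k, Set.InjOn f q.orbit := by
    induction q using Quotient.inductionOn' with
    | h x =>
      rw [MulAction.orbitRel.Quotient.orbit_mk]
      have : Finite (MulAction.orbit Γ x) := Set.finite_range _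
      have := Fintype.ofFinite (MulAction.orbit Γ x)
      have : Nonempty (MulAction.orbit Γ x) := (MulAction.nonempty_orbit x).to_subtype
      have hpos : 0 < Nat.card (MulAction.orbit Γ x) := Nat.card_pos
      have : Nonempty (Fin k) := ⟨⟨0, hpos.trans_le (h x)⟩⟩
      obtain ⟨e⟩ : Nonempty (MulAction.orbit Γ x ↪ Fin k) :=
        Function.Embedding.nonempty_of_card_le (by simpa [Nat.card_eq_fintype_card] using h x)
      classical
      refine ⟨fun y ↦ if hy : y ∈ MulAction.orbit Γ x then e ⟨y, hy⟩ else Classical.arbitrary _,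
        fun y hy z hz hyz ↦ ?_⟩
      simpa [hy, hz] using hyz
  choose f hf using hinj
  refine ⟨fun x ↦ f (Quotient.mk'' x) x, fun g hg x ↦ hf (Quotient.mk'' x) ?_ ?_ ?_⟩
  · rw [MulAction.orbitRel.Quotient.orbit_mk]
    exact MulAction.mem_orbit x g
  · rw [MulAction.orbitRel.Quotient.orbit_mk]
    exact MulAction.mem_orbit_self x
  · have hq : (Quotient.mk'' (g • x) : MulAction.orbitRel.Quotient Γ X) = Quotient.mk'' x :=
      Quotient.sound' (MulAction.mem_orbit x g)
    simpa only [hq] using hg x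

open Classical in
/-- Giving `x` a new label turns a distinguishing labelling for the stabilizer of `x` into one
for the whole group. -/
theorem IsDistinguishing.update_last {Γ X : Type*} [Group Γ] [MulAction Γ X] {k : ℕ} {x : X}
    {φ : X → Fin k} (hφ : IsDistinguishing (MulAction.stabilizer Γ x) φ) :
    IsDistinguishing Γ (Function.update (fun y ↦ (φ y).castSucc) x (Fin.last k)) := by
  intro g hg
  have hgx : g • x = x := by
    by_contra hne
    have := hg x
    rw [Function.update_of_ne hne, Function.update_self] at this
    exact (Fin.castSucc_lt_last _).ne this
  refine hφ ⟨g, hgx⟩ fun y ↦ ?_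
  change φ (g • y) = φ y
  by_cases hy : y = x
  · rw [hy, hgx]
  · have hgy : g • y ≠ x := fun h ↦ hy (MulAction.injective g (h.trans hgx.symm))
    simpa [hy, hgy] using hg y

theorem exists_isDistinguishing_of_card_le_factorial {X : Type*} (k : ℕ) (Γ : Type*) [Group Γ]
    [Finite Γ] [MulAction Γ X] (h : Nat.card Γ ≤ (k + 1).factorial) :
    ∃ φ : X → Fin (k + 1), IsDistinguishing Γ φ := by
  induction k generalizing Γ with
  | zero =>
    have : Subsingleton Γ := Finite.card_le_one_iff_subsingleton.mp (by simpa using h)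
    exact ⟨fun _ ↦ 0, fun g _ x ↦ by rw [Subsingleton.elim g 1, one_smul]⟩
  | succ k ih =>
    by_cases horb : ∀ x : X, Nat.card (MulAction.orbit Γ x) ≤ k + 2
    · exact exists_isDistinguishing_of_card_orbit_le horb
    push Not at horb
    obtain ⟨x, hx⟩ := horb
    have hcard : Nat.card (MulAction.orbit Γ x) * Nat.card (MulAction.stabilizer Γ x)
        = Nat.card Γ := by
      rw [← Nat.card_prod, Nat.card_congr (MulAction.orbitProdStabilizerEquivGroup Γ x)]
    obtain ⟨φ, hφ⟩ := ih (MulAction.stabilizer Γ x) (by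
      rw [Nat.factorial_succ (k + 1), ← hcard] at h
      exact Nat.le_of_mul_le_mul_left ((Nat.mul_le_mul_right _ hx.le).trans h) (by lia))
    exact ⟨_, hφ.update_last⟩

/-- If `|Γ| ≤ k!` then the distinguishing number of any action of `Γ` on a finite
nonempty set `X` is at most `k`. -/
theorem distinguishingNumber_le_of_card_le_factorial
    (Γ X : Type*) [Group Γ] [Fintype Γ] [MulAction Γ X] [Fintype X] [Nonempty X]
    (k : ℕ) (hk : 1 ≤ k) (h : Fintype.card Γ ≤ Nat.factorial k) :
    distinguishingNumber Γ X ≤ k := by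
  obtain ⟨k, rfl⟩ := Nat.exists_eq_add_of_le' hk
  exact Nat.sInf_le (exists_isDistinguishing_of_card_le_factorial k Γ
    (by rwa [Nat.card_eq_fintype_card]))
end

section
/- Let Γ be a finite group acting on a finite set X with |Γ| ≤ k! for some k ≥ 1, and let O be any orbit of this action. Then there is a labelling φ : O → {1,…,k} such that every g ∈ Γ satisfying φ(g·x) = φ(x) for all x ∈ O in fact satisfies g·x = x for all x ∈ O. -/
/-- If every orbit of a finite group has at most `n + 1` points, some labelling with `n + 1` labels
is injective on each orbit. -/
theorem MulAction.exists_injOn_orbit {G Y : Type*} [Group G] [Finite G] [MulAction G Y] (n : ℕ)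
    (h : ∀ y : Y, Nat.card (MulAction.orbit G y) ≤ n + 1) :
    ∃ φ : Y → Fin (n + 1), ∀ y : Y, Set.InjOn φ (MulAction.orbit G y) := by
  have key : ∀ q : MulAction.orbitRel.Quotient G Y,
      ∃ f : Y → Fin (n + 1), Set.InjOn f q.orbit := by
    intro q
    induction q using Quotient.inductionOn' with | h y =>
    rw [MulAction.orbitRel.Quotient.orbit_mk]
    have hfin : (MulAction.orbit G y).Finite := Set.finite_range _
    obtain ⟨f, -, hf⟩ := hfin.exists_injOn_of_encard_le
      (t := (Set.univ : Set (Fin (n + 1)))) (by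
        rw [← hfin.cast_ncard_eq, Set.encard_univ]
        simpa using mod_cast h y)
    exact ⟨f, hf⟩
  choose f hf using key
  refine ⟨fun y ↦ f (Quotient.mk'' y) y, fun y a ha b hb hab ↦ ?_⟩
  have ha' : (Quotient.mk'' a : MulAction.orbitRel.Quotient G Y) = Quotient.mk'' y :=
    Quotient.sound' ha
  have hb' : (Quotient.mk'' b : MulAction.orbitRel.Quotient G Y) = Quotient.mk'' y :=
    Quotient.sound' hb
  simp only [ha', hb'] at hab
  exact hf (Quotient.mk'' y) ha hb hab

/-- An action of a group of order at most `(n + 1)!` can be distinguished with `n + 1` labels. -/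
theorem MulAction.exists_distinguishing_of_card_le_factorial {G Y : Type*} [Group G] [Finite G]
    [MulAction G Y] (n : ℕ) (h : Nat.card G ≤ (n + 1).factorial) :
    ∃ φ : Y → Fin (n + 1), ∀ g : G, (∀ y, φ (g • y) = φ y) → ∀ y : Y, g • y = y := by
  induction n generalizing G with
  | zero =>
    have : Subsingleton G := Finite.card_le_one_iff_subsingleton.mp (by simpa using h)
    exact ⟨fun _ ↦ 0, fun g _ y ↦ by rw [Subsingleton.elim g 1, one_smul]⟩
  | succ n ih =>
    by_cases hx : ∃ x : Y, n + 2 ≤ Nat.card (MulAction.orbit G x)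
    · obtain ⟨x, hx⟩ := hx
      have hcard : Nat.card (MulAction.stabilizer G x) ≤ (n + 1).factorial := by
        have e := Nat.card_congr (MulAction.orbitProdStabilizerEquivGroup G x)
        rw [Nat.card_prod] at e
        rw [← e, Nat.factorial_succ (n + 1)] at h
        exact Nat.le_of_mul_le_mul_left ((Nat.mul_le_mul_right _ hx).trans h) (by omega)
      obtain ⟨φ, hφ⟩ := ih hcard
      classical
      refine ⟨fun y ↦ if y = x then Fin.last _ else (φ y).castSucc, fun g hg ↦ ?_⟩
      have hgx : g • x = x := by
        by_contra hne
        have := hg x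
        simp only [hne, if_true, if_false] at this
        exact Fin.castSucc_ne_last _ this
      refine hφ ⟨g, hgx⟩ fun y ↦ ?_
      change φ (g • y) = φ y
      by_cases hy : y = x
      · rw [hy, hgx]
      · have hgy : g • y ≠ x := fun e ↦ hy (MulAction.injective g (e.trans hgx.symm))
        simpa [hy, hgy] using hg y
    · push Not at hx
      obtain ⟨φ, hφ⟩ := MulAction.exists_injOn_orbit (G := G) (Y := Y) (n + 1)
        fun y ↦ (hx y).le
      exact ⟨φ, fun g hg y ↦
        hφ y (MulAction.mem_orbit y g) (MulAction.mem_orbit_self y) (hg y)⟩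

/-- If `|Γ| ≤ k!` and `O = Γ·x₀` is any orbit of the action of `Γ` on `X`,
then `O` can be distinguished under the action of `Γ` using at most `k` labels:
there is a labelling of `X` whose restriction to `O` is only preserved by group
elements fixing `O` pointwise. -/
theorem orbit_distinguishable_of_card_le_factorial
    (Γ X : Type*) [Group Γ] [Fintype Γ] [MulAction Γ X] [Fintype X]
    (k : ℕ) (hk : 1 ≤ k) (h : Fintype.card Γ ≤ Nat.factorial k) (x₀ : X) :
    ∃ φ : X → Fin k, ∀ g : Γ,
      (∀ x ∈ MulAction.orbit Γ x₀, φ (g • x) = φ x) →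
      ∀ x ∈ MulAction.orbit Γ x₀, g • x = x := by
  obtain ⟨n, rfl⟩ := Nat.exists_eq_add_of_le' hk
  obtain ⟨φ, hφ⟩ := MulAction.exists_distinguishing_of_card_le_factorial (G := Γ)
    (Y := MulAction.orbit Γ x₀) n (by rwa [Nat.card_eq_fintype_card])
  classical
  refine ⟨fun x ↦ if hx : x ∈ MulAction.orbit Γ x₀ then φ ⟨x, hx⟩ else 0, fun g hg x hx ↦ ?_⟩
  refine congrArg Subtype.val (hφ g (fun y ↦ ?_) ⟨x, hx⟩)
  have hgy : g • (y : X) ∈ MulAction.orbit Γ x₀ := (g • y).2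
  have := hg y y.2
  simp only [dif_pos hgy, dif_pos y.2] at this
  exact this
end

section
/- Let X be the conjugacy class of the 4-cycle (1 2 3 4) in the symmetric group S₄ (the set of all six 4-cycles), with S₄ acting on X by conjugation. Then D_{S₄}(X) = 3. In particular, there exists a faithful action of S₄ on a finite set whose distinguishing number is exactly 3. -/
/-- The distinguishing number of the conjugation action of a group on a
conjugation-invariant subset `S`: the least `k` such that some labelling of `S`
with `k` labels is preserved only by group elements whose conjugation fixes `S`
pointwise. -/
noncomputable def conjDistinguishingNumber {α : Type*} [Group α] (S : Set α) : ℕ :=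
  sInf {k : ℕ | ∃ φ : α → Fin k, ∀ g : α,
    (∀ x ∈ S, φ (g * x * g⁻¹) = φ x) → ∀ x ∈ S, g * x * g⁻¹ = x}

/-- The six four-cycles in `S₄`. -/
def fourCycles : List (Equiv.Perm (Fin 4)) :=
  [finRotate 4, (finRotate 4)⁻¹,
    Equiv.swap 1 2 * finRotate 4 * Equiv.swap 1 2,
    Equiv.swap 1 2 * (finRotate 4)⁻¹ * Equiv.swap 1 2,
    Equiv.swap 2 3 * finRotate 4 * Equiv.swap 2 3,
    Equiv.swap 2 3 * (finRotate 4)⁻¹ * Equiv.swap 2 3]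

theorem mem_fourCycles_iff :
    ∀ x : Equiv.Perm (Fin 4), x ∈ fourCycles ↔ IsConj (finRotate 4) x := by
  decide +kernel

/-- Every set of four-cycles is preserved by a nontrivial conjugation. -/
theorem exists_ne_one_conj_mem_iff : ∀ s ∈ fourCycles.sublists,
    ∃ g : Equiv.Perm (Fin 4), g ≠ 1 ∧ ∀ x ∈ fourCycles, g * x * g⁻¹ ∈ s ↔ x ∈ s := by
  decide +kernel

/-- Two four-cycles that are neither equal nor mutually inverse have no common nontrivial
centralizing element. -/
theorem eq_one_of_conj_eq : ∀ x ∈ fourCycles, ∀ y ∈ fourCycles, x ≠ y → x ≠ y⁻¹ →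
    ∀ g : Equiv.Perm (Fin 4), g * x * g⁻¹ = x → g * y * g⁻¹ = y → g = 1 := by
  decide +kernel

theorem exists_fourCycles_ne : ∃ x ∈ fourCycles, ∃ y ∈ fourCycles, x ≠ y ∧ x ≠ y⁻¹ := by
  decide +kernel

theorem eq_one_of_forall_conj_eq (g : Equiv.Perm (Fin 4))
    (h : ∀ x, IsConj (finRotate 4) x → g * x * g⁻¹ = x) : g = 1 := by
  obtain ⟨x, hx, y, hy, hxy, hxy'⟩ := exists_fourCycles_ne
  exact eq_one_of_conj_eq x hx y hy hxy hxy' g (h x ((mem_fourCycles_iff x).1 hx))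
    (h y ((mem_fourCycles_iff y).1 hy))

/-- No labelling of the four-cycles with two labels is distinguishing. -/
theorem exists_ne_one_label_conj_eq (φ : Equiv.Perm (Fin 4) → Fin 2) :
    ∃ g : Equiv.Perm (Fin 4), g ≠ 1 ∧
      ∀ x, IsConj (finRotate 4) x → φ (g * x * g⁻¹) = φ x := by
  obtain ⟨g, hg, h⟩ := exists_ne_one_conj_mem_iff (fourCycles.filter (φ · = 0))
    (List.mem_sublists.2 List.filter_sublist)
  refine ⟨g, hg, fun x hx => ?_⟩
  have hgx : IsConj (finRotate 4) (g * x * g⁻¹) := hx.trans (isConj_iff.2 ⟨g, rfl⟩)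
  have := h x ((mem_fourCycles_iff x).2 hx)
  simp only [List.mem_filter, mem_fourCycles_iff, hx, hgx, true_and, decide_eq_true_eq] at this
  omega

/-- Let `X` be the conjugacy class of the 4-cycle `(0 1 2 3)` (i.e. `finRotate 4`)
in `S₄`, with `S₄` acting by conjugation.  Then `D_{S₄}(X) = 3`, and moreover this
action is faithful. -/
theorem conjDistinguishingNumber_fourCycles :
    conjDistinguishingNumber {x : Equiv.Perm (Fin 4) | IsConj (finRotate 4) x} = 3 ∧
      ∀ g : Equiv.Perm (Fin 4),
        (∀ x ∈ {x : Equiv.Perm (Fin 4) | IsConj (finRotate 4) x}, g * x * g⁻¹ = x) →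
        g = 1 := by
  refine ⟨IsLeast.csInf_eq ⟨?_, ?_⟩, eq_one_of_forall_conj_eq⟩
  · obtain ⟨x, hx, y, hy, hxy, hxy'⟩ := exists_fourCycles_ne
    refine ⟨fun w => if w = x then 0 else if w = y then 1 else 2, fun g hg => ?_⟩
    have hgx : g * x * g⁻¹ = x := by
      have := hg x ((mem_fourCycles_iff x).1 hx)
      grind
    have hgy : g * y * g⁻¹ = y := by
      have := hg y ((mem_fourCycles_iff y).1 hy)
      grind
    simp [eq_one_of_conj_eq x hx y hy hxy hxy' g hgx hgy]
  · rintro k ⟨φ, hφ⟩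
    by_contra! hk
    have hk2 : k ≤ 2 := by omega
    obtain ⟨g, hg, h⟩ := exists_ne_one_label_conj_eq (fun w => Fin.castLE hk2 (φ w))
    exact hg (eq_one_of_forall_conj_eq g
      (hφ g fun x hx => Fin.castLE_injective hk2 (h x hx)))
end

section
/- Let T be a finite tree (a connected acyclic simple graph) whose maximum vertex degree d satisfies d ≥ 2. Then D(T) ≤ d. Moreover, a tree with exactly one vertex has distinguishing number 1, and a tree with exactly two vertices has distinguishing number 2. -/
/-- A labelling `φ : V → Fin k` of the vertices of a simple graph `G` is
distinguishing if the only graph automorphism preserving it is the identity. -/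
def IsGraphDistinguishing {V : Type*} (G : SimpleGraph V) {k : ℕ} (φ : V → Fin k) : Prop :=
  ∀ σ : G ≃g G, (∀ v : V, φ (σ v) = φ v) → ∀ v : V, σ v = v

/-- The distinguishing number `D(G)` of a simple graph `G`: the least number of
labels admitting a distinguishing labelling. -/
noncomputable def graphDistinguishingNumber {V : Type*} (G : SimpleGraph V) : ℕ :=
  sInf {k : ℕ | ∃ φ : V → Fin k, IsGraphDistinguishing G φ}

namespace SimpleGraph

variable {V : Type*} {G : SimpleGraph V}

theorem Iso.dist_apply_apply {W : Type*} {H : SimpleGraph W} (hconn : G.Connected)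
    (σ : G ≃g H) (u v : V) : H.dist (σ u) (σ v) = G.dist u v := by
  have hconn' : H.Connected := σ.connected_iff.mp hconn
  apply le_antisymm
  · obtain ⟨p, hp⟩ := hconn.exists_walk_length_eq_dist u v
    simpa [hp] using dist_le (p.map σ.toHom)
  · obtain ⟨p, hp⟩ := hconn'.exists_walk_length_eq_dist (σ u) (σ v)
    have h := dist_le (p.map σ.symm.toHom)
    rw [Walk.length_map, hp] at h
    simpa using h

/-- Every vertex other than the root has a neighbour one step closer to the root. -/
theorem Connected.exists_adj_dist_eq_add_one (hconn : G.Connected) {r v : V} (hv : v ≠ r) :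
    ∃ p, G.Adj v p ∧ G.dist v r = G.dist p r + 1 := by
  obtain ⟨w, hw⟩ := hconn.exists_walk_length_eq_dist v r
  cases w with
  | nil => exact absurd rfl hv
  | @cons _ p _ hadj w =>
    refine ⟨p, hadj, ?_⟩
    have h₁ : G.dist p r ≤ w.length := dist_le w
    have h₂ : G.dist v r ≤ G.dist v p + G.dist p r := hconn.dist_triangle
    rw [dist_eq_one_iff_adj.mpr hadj] at h₂
    rw [Walk.length_cons] at hw
    omega

/-- In an acyclic graph, the neighbour one step closer to the root is unique. -/
theorem IsAcyclic.eq_of_adj_of_dist_eq_add_one (hacyc : G.IsAcyclic) (hconn : G.Connected)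
    {r v p q : V} (hp : G.Adj v p) (hq : G.Adj v q) (hpd : G.dist v r = G.dist p r + 1)
    (hqd : G.dist v r = G.dist q r + 1) : p = q := by
  obtain ⟨wp, hwp⟩ := hconn.exists_walk_length_eq_dist p r
  obtain ⟨wq, hwq⟩ := hconn.exists_walk_length_eq_dist q r
  have hP : (Walk.cons hp wp).IsPath :=
    Walk.isPath_of_length_eq_dist _ (by rw [Walk.length_cons, hwp, hpd])
  have hQ : (Walk.cons hq wq).IsPath :=
    Walk.isPath_of_length_eq_dist _ (by rw [Walk.length_cons, hwq, hqd])
  have h := congrArg Subtype.val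
    ((hacyc.subsingleton_path v r).elim ⟨_, hP⟩ ⟨_, hQ⟩)
  simpa using congrArg Walk.snd h

/-- If the root is a leaf, every vertex has at most `Δ - 1` children. -/
theorem Connected.card_children_lt_maxDegree [Fintype V] [DecidableRel G.Adj]
    (hconn : G.Connected) (hdeg : 2 ≤ G.maxDegree) {r : V} (hr : G.degree r = 1) (u : V) :
    ((G.neighborFinset u).filter fun w => G.dist w r = G.dist u r + 1).card < G.maxDegree := by
  by_cases hu : u = r
  · subst hu
    calc _ ≤ (G.neighborFinset u).card := Finset.card_filter_le _ _
      _ = 1 := hr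
      _ < G.maxDegree := by omega
  · obtain ⟨p, hp, hpd⟩ := hconn.exists_adj_dist_eq_add_one hu
    refine lt_of_lt_of_le (Finset.card_lt_card ?_) (G.degree_le_maxDegree u)
    refine Finset.filter_ssubset.mpr ⟨p, by simpa using hp, ?_⟩
    omega

end SimpleGraph

theorem Finset.exists_injOn_fin {α : Type*} {m : ℕ} (hm : 0 < m) (s : Finset α)
    (hs : s.card ≤ m) : ∃ f : α → Fin m, Set.InjOn f s := by
  classical
  obtain ⟨e⟩ := Function.Embedding.nonempty_of_card_le (α := s) (β := Fin m) (by simpa using hs)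
  refine ⟨fun a => if h : a ∈ s then e ⟨a, h⟩ else ⟨0, hm⟩, fun a ha b hb hab => ?_⟩
  have ha' : a ∈ s := ha
  have hb' : b ∈ s := hb
  simpa [ha', hb'] using hab

/-- Label the root, a leaf, with `0`, and the children of each vertex with distinct nonzero
labels. -/
theorem exists_isGraphDistinguishing_maxDegree {V : Type*} [Fintype V] {T : SimpleGraph V}
    [DecidableRel T.Adj] (hconn : T.Connected) (hacyc : T.IsAcyclic) (hdeg : 2 ≤ T.maxDegree) :
    ∃ φ : V → Fin T.maxDegree, IsGraphDistinguishing T φ := by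
  classical
  have : Nontrivial V := by
    by_contra h
    rw [not_nontrivial_iff_subsingleton] at h
    have := hconn.nonempty
    obtain ⟨v, hv⟩ := T.exists_maximal_degree_vertex
    have := T.degree_lt_card_verts v
    have := Fintype.card_le_one_iff_subsingleton.mpr h
    omega
  obtain ⟨r, hr⟩ :=
    (SimpleGraph.IsTree.mk hconn hacyc).exists_vert_degree_one_of_nontrivial
  have hcard := hconn.card_children_lt_maxDegree hdeg hr
  obtain ⟨m, hm⟩ : ∃ m, T.maxDegree = m + 1 := ⟨T.maxDegree - 1, by omega⟩
  rw [hm] at hdeg hcard ⊢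
  choose f hf using fun u => Finset.exists_injOn_fin (by omega : 0 < m) _
    (Nat.lt_succ_iff.mp (hcard u))
  have hparent : ∀ v, ∃ p, v ≠ r → T.Adj v p ∧ T.dist v r = T.dist p r + 1 := fun v => by
    by_cases hv : v = r
    · exact ⟨r, fun h => absurd hv h⟩
    · obtain ⟨p, hp⟩ := hconn.exists_adj_dist_eq_add_one hv
      exact ⟨p, fun _ => hp⟩
  choose parent hparent using hparent
  refine ⟨fun v => if v = r then 0 else (f (parent v) v).succ, fun σ hσ => ?_⟩
  have hσr : σ r = r := by
    by_contra h
    have := hσ r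
    simp [h] at this
  have hdist : ∀ v, T.dist (σ v) r = T.dist v r := fun v => by
    simpa [hσr] using σ.dist_apply_apply hconn v r
  suffices ∀ n v, T.dist v r = n → σ v = v from fun v => this _ v rfl
  intro n
  induction n with
  | zero =>
    intro v hv
    rw [hconn.dist_eq_zero_iff] at hv
    rw [hv, hσr]
  | succ n ih =>
    intro v hv
    have hvr : v ≠ r := by
      rintro rfl
      simp at hv
    have hσvr : σ v ≠ r := fun h => hvr (σ.injective (h.trans hσr.symm))
    obtain ⟨hadj, hd⟩ := hparent v hvr
    obtain ⟨hadj', hd'⟩ := hparent (σ v) hσvr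
    have hfix : σ (parent v) = parent v := ih _ (by omega)
    have hadj'' : T.Adj (σ v) (parent v) := hfix ▸ σ.map_adj_iff.mpr hadj
    have heq : parent (σ v) = parent v :=
      hacyc.eq_of_adj_of_dist_eq_add_one hconn hadj' hadj'' hd' (by rw [hdist, hd])
    have hlabel := hσ v
    simp only [hvr, hσvr, if_false, heq, Fin.succ_inj] at hlabel
    refine hf (parent v) ?_ ?_ hlabel
    · simpa [hdist] using ⟨hadj''.symm, hd⟩
    · simpa using ⟨hadj.symm, hd⟩

theorem graphDistinguishingNumber_le {V : Type*} {G : SimpleGraph V} {k : ℕ} {φ : V → Fin k}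
    (h : IsGraphDistinguishing G φ) : graphDistinguishingNumber G ≤ k :=
  Nat.sInf_le ⟨φ, h⟩

theorem graphDistinguishingNumber_eq_one {V : Type*} [Nonempty V] [Subsingleton V]
    (G : SimpleGraph V) : graphDistinguishingNumber G = 1 := by
  have h : IsGraphDistinguishing G (fun _ => (0 : Fin 1)) :=
    fun _ _ _ => Subsingleton.elim _ _
  apply le_antisymm (graphDistinguishingNumber_le h)
  refine le_csInf ⟨1, _, h⟩ ?_
  rintro k ⟨φ, -⟩
  obtain ⟨v⟩ := ‹Nonempty V›
  exact (φ v).pos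

/-- A graph on two vertices has distinguishing number `2`: swapping them is an automorphism. -/
theorem graphDistinguishingNumber_eq_two {V : Type*} [Fintype V] (G : SimpleGraph V)
    (hV : Fintype.card V = 2) : graphDistinguishingNumber G = 2 := by
  classical
  obtain ⟨φ⟩ : Nonempty (V ≃ Fin 2) := ⟨Fintype.equivFinOfCardEq hV⟩
  have h : IsGraphDistinguishing G φ := fun _ hσ v => φ.injective (hσ v)
  apply le_antisymm (graphDistinguishingNumber_le h)
  refine le_csInf ⟨2, _, h⟩ ?_
  rintro k ⟨ψ, hψ⟩
  obtain ⟨a, b, hab, huniv⟩ := Nat.card_eq_two_iff.mp (Nat.card_eq_fintype_card.trans hV)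
  have hcases : ∀ v, v = a ∨ v = b := fun v => huniv.symm.subset (Set.mem_univ v)
  by_contra! hk
  have : Subsingleton (Fin k) := Fin.subsingleton_iff_le_one.mpr (by omega)
  let σ : G ≃g G := ⟨Equiv.swap a b, by
    intro u v
    rcases hcases u with rfl | rfl <;> rcases hcases v with rfl | rfl <;>
      simp [G.adj_comm]⟩
  have := hψ σ (fun v => Subsingleton.elim _ _) a
  exact hab ((Equiv.swap_apply_left a b).symm.trans this).symm

/-- A finite tree `T` with maximum degree `d ≥ 2` has `D(T) ≤ d`; a tree with one
vertex has distinguishing number 1, and a tree with two vertices has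
distinguishing number 2. -/
theorem graphDistinguishingNumber_tree
    (V : Type*) [Fintype V] (T : SimpleGraph V) [DecidableRel T.Adj]
    (hconn : T.Connected) (hacyc : T.IsAcyclic) :
    (2 ≤ T.maxDegree → graphDistinguishingNumber T ≤ T.maxDegree) ∧
      (Fintype.card V = 1 → graphDistinguishingNumber T = 1) ∧
      (Fintype.card V = 2 → graphDistinguishingNumber T = 2) := by
  refine ⟨fun hdeg => ?_, fun hV => ?_, graphDistinguishingNumber_eq_two T⟩
  · obtain ⟨φ, hφ⟩ := exists_isGraphDistinguishing_maxDegree hconn hacyc hdeg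
    exact graphDistinguishingNumber_le hφ
  · have := hconn.nonempty
    have := Fintype.card_le_one_iff_subsingleton.mp hV.le
    exact graphDistinguishingNumber_eq_one T
end

section
/- For the cycle graph C_n on n vertices: D(C_n) = 3 when n ∈ {3, 4, 5}, and D(C_n) = 2 when n ≥ 6. -/
namespace SimpleGraph

theorem cycleGraph_adj_iff_val {n : ℕ} {u v : Fin (n + 3)} :
    (cycleGraph (n + 3)).Adj u v ↔ u.val + 1 = v.val ∨ v.val + 1 = u.val ∨
      (u.val = 0 ∧ v.val = n + 2) ∨ (v.val = 0 ∧ u.val = n + 2) := by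
  rw [cycleGraph_adj']
  have hu := u.isLt
  have hv := v.isLt
  rcases le_total u v with h | h <;> rcases eq_or_lt_of_le h with h' | h'
  · subst h'; simp only [sub_self, Fin.val_zero]; omega
  · rw [Fin.coe_sub_iff_lt.2 h', Fin.coe_sub_iff_le.2 h]
    rw [Fin.lt_def] at h'
    omega
  · subst h'; simp only [sub_self, Fin.val_zero]; omega
  · rw [Fin.coe_sub_iff_lt.2 h', Fin.coe_sub_iff_le.2 h]
    rw [Fin.lt_def] at h'
    omega

/-- The reflection `v ↦ c - v` of a cycle graph. -/
def cycleGraphReflection {n : ℕ} (c : Fin (n + 3)) :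
    cycleGraph (n + 3) ≃g cycleGraph (n + 3) where
  toEquiv := Equiv.subLeft c
  map_rel_iff' {u v} := by
    simp only [cycleGraph_adj', Equiv.subLeft_apply, sub_sub_sub_cancel_left]
    exact or_comm

theorem exists_cycleGraphReflection_apply_ne {n : ℕ} (c : Fin (n + 3)) :
    ∃ v, cycleGraphReflection c v ≠ v := by
  by_contra! h
  have h0 : c - 0 = 0 := h 0
  have h1 : c - 1 = 1 := h 1
  rw [sub_zero] at h0
  rw [h0, sub_eq_iff_eq_add] at h1
  have := congrArg Fin.val h1
  rw [Fin.val_add, Fin.val_one, Nat.mod_eq_of_lt (by omega)] at this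
  simp at this

theorem cycleGraph_iso_apply_eq_self {n : ℕ} (σ : cycleGraph (n + 3) ≃g cycleGraph (n + 3))
    (h0 : σ 0 = 0) (h1 : σ 1 = 1) (v : Fin (n + 3)) : σ v = v := by
  obtain ⟨m, hm⟩ := v
  induction m using Nat.twoStepInduction with
  | zero => exact h0
  | one => exact h1
  | more m ih ih' =>
    have hadj : (cycleGraph (n + 3)).Adj ⟨m + 1, by omega⟩ ⟨m + 2, hm⟩ :=
      cycleGraph_adj_iff_val.2 (Or.inl rfl)
    have hne : σ ⟨m + 2, hm⟩ ≠ σ ⟨m, by omega⟩ := σ.injective.ne (by simp)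
    rw [← σ.map_adj_iff, ih' (by omega), cycleGraph_adj_iff_val] at hadj
    rw [ih (by omega), Ne, Fin.ext_iff] at hne
    ext
    have := (σ ⟨m + 2, hm⟩).isLt
    simp only at hadj hne ⊢
    omega

end SimpleGraph

open SimpleGraph

theorem not_isGraphDistinguishing_of_reflection {n k : ℕ} {φ : Fin (n + 3) → Fin k}
    (h : ∃ c, ∀ v, φ (c - v) = φ v) : ¬ IsGraphDistinguishing (cycleGraph (n + 3)) φ := by
  obtain ⟨c, hc⟩ := h
  intro hφ
  obtain ⟨v, hv⟩ := exists_cycleGraphReflection_apply_ne c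
  exact hv (hφ (cycleGraphReflection c) hc v)

theorem two_le_of_isGraphDistinguishing_cycleGraph {n k : ℕ} {φ : Fin (n + 3) → Fin k}
    (hφ : IsGraphDistinguishing (cycleGraph (n + 3)) φ) : 2 ≤ k := by
  by_contra! hk
  have : Subsingleton (Fin k) := Fin.subsingleton_iff_le_one.2 (by omega)
  exact not_isGraphDistinguishing_of_reflection ⟨0, fun _ => Subsingleton.elim _ _⟩ hφ

theorem exists_reflection_invariant_of_le_five {n : ℕ} (hn : n + 3 ≤ 5)
    (φ : Fin (n + 3) → Fin 2) : ∃ c, ∀ v, φ (c - v) = φ v := by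
  have : n ≤ 2 := by omega
  interval_cases n <;> revert φ <;> decide

theorem isGraphDistinguishing_cycleGraph_three_labels (n : ℕ) :
    IsGraphDistinguishing (cycleGraph (n + 3))
      (fun v => (⟨min v.val 2, by omega⟩ : Fin 3)) := by
  intro σ hσ
  have h0 := hσ 0
  have h1 := hσ 1
  simp only [Fin.ext_iff, Fin.val_zero, Fin.val_one] at h0 h1
  exact cycleGraph_iso_apply_eq_self σ (Fin.ext (by simp only [Fin.val_zero]; omega))
    (Fin.ext (by simp only [Fin.val_one]; omega))

theorem isGraphDistinguishing_cycleGraph_two_labels {n : ℕ} (hn : 6 ≤ n + 3) :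
    IsGraphDistinguishing (cycleGraph (n + 3))
      (fun v => if v.val = 0 ∨ v.val = 1 ∨ v.val = 3 then (1 : Fin 2) else 0) := by
  intro σ hσ
  have key (v : Fin (n + 3)) (hv : v.val = 0 ∨ v.val = 1 ∨ v.val = 3) :
      (σ v).val = 0 ∨ (σ v).val = 1 ∨ (σ v).val = 3 := by
    by_contra h
    have := hσ v
    simp only [if_pos hv, if_neg h, zero_ne_one] at this
  have hadj (u v : Fin (n + 3)) := σ.map_adj_iff (v := u) (w := v)
  simp only [cycleGraph_adj_iff_val] at hadj
  let w : Fin (n + 3) := ⟨2, by omega⟩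
  let x : Fin (n + 3) := ⟨3, by omega⟩
  have k0 := key 0 (by simp)
  have k1 := key 1 (by simp)
  have k3 := key x (by simp [x])
  have a01 := hadj 0 1
  have a03 := hadj 0 x
  have a13 := hadj 1 x
  have a12 := hadj 1 w
  have a23 := hadj w x
  simp only [Fin.val_zero, Fin.val_one, w, x, true_or, true_and, iff_true] at k0 k1 k3 a01 a03 a13 a12 a23
  have h : (σ 0).val = 0 ∧ (σ 1).val = 1 := by
    rcases k0 with k0 | k0 | k0 <;> rcases k1 with k1 | k1 | k1 <;>
      rcases k3 with k3 | k3 | k3 <;> omega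
  exact cycleGraph_iso_apply_eq_self σ (Fin.ext h.1) (Fin.ext h.2)

/-- The distinguishing number of the cycle graph `Cₙ`: it is 3 for
`n ∈ {3, 4, 5}` and 2 for `n ≥ 6`. -/
theorem graphDistinguishingNumber_cycleGraph (n : ℕ) :
    ((n = 3 ∨ n = 4 ∨ n = 5) →
      graphDistinguishingNumber (SimpleGraph.cycleGraph n) = 3) ∧
    (6 ≤ n → graphDistinguishingNumber (SimpleGraph.cycleGraph n) = 2) := by
  constructor <;> intro hn <;> obtain ⟨m, rfl⟩ : ∃ m, n = m + 3 := ⟨n - 3, by omega⟩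
  · have h3 := isGraphDistinguishing_cycleGraph_three_labels m
    refine le_antisymm (Nat.sInf_le ⟨_, h3⟩) (le_csInf ⟨3, _, h3⟩ ?_)
    rintro k ⟨φ, hφ⟩
    have hk := two_le_of_isGraphDistinguishing_cycleGraph hφ
    by_contra! hlt
    obtain rfl : k = 2 := by omega
    exact not_isGraphDistinguishing_of_reflection
      (exists_reflection_invariant_of_le_five (by omega) φ) hφ
  · have h2 := isGraphDistinguishing_cycleGraph_two_labels hn
    refine le_antisymm (Nat.sInf_le ⟨_, h2⟩) (le_csInf ⟨2, _, h2⟩ ?_)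
    rintro k ⟨φ, hφ⟩
    exact two_le_of_isGraphDistinguishing_cycleGraph hφ
end
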